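/- arXiv:1107.3908 — 5 statements merged into one kernel-verified Lean document; each statement's English description precedes it below -/
import Mathlib

section
/- Let A1, A2, B1, B2 be groups with A2 and B2 abelian and A2 finitely generated. Let A3 be a set equipped with an action of A2 and B3 a set equipped with an action of B2. Let f1 : A1 → A2, g1 : B1 → B2, ℓ1 : A1 → B1, ℓ2 : A2 → B2 be group homomorphisms with ℓ2 ∘ f1 = g1 ∘ ℓ1, and let ℓ3 : A3 → B3 be a map. Fix a3 ∈ A3. Assume: (i) ℓ1 is Q-surjective and the kernel of ℓ2 is finite; (ii) ℓ3 is equivariant, i.e. ℓ3(a2 · a) = ℓ2(a2) · ℓ3(a) for all a2 ∈ A2 and a ∈ A3; (iv) the stabilizer of a3 under the A2-action is exactly the image of f1, and the stabilizer of ℓ3(a3) under the B2-action is exactly the image of g1. Then the set (A2 · a3) ∩ ℓ3⁻¹(ℓ3(a3)) is finite. -/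
/-- A group homomorphism `ℓ₁ : A₁ →* B₁` is `ℚ`-surjective if for every `b : B₁`
there is a positive integer `n` with `b ^ n` in the image of `ℓ₁`. -/
def QSurjective {A₁ B₁ : Type*} [Group A₁] [Group B₁] (ℓ₁ : A₁ →* B₁) : Prop :=
  ∀ b : B₁, ∃ n : ℕ, 0 < n ∧ b ^ n ∈ ℓ₁.range

/-- Subgroups of finitely generated abelian groups are finitely generated. -/
theorem CommGroup.fg_subgroup {G : Type*} [CommGroup G] [Group.FG G] (H : Subgroup G) :
    Group.FG H := by
  have : Module.Finite ℤ (Additive G) := Module.Finite.iff_addGroup_fg.mpr inferInstance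
  have hfg : (AddSubgroup.toIntSubmodule (Subgroup.toAddSubgroup H)).FG :=
    IsNoetherian.noetherian _
  rw [Submodule.fg_iff_addSubgroup_fg] at hfg
  rw [Group.fg_iff_subgroup_fg, Subgroup.fg_iff_add_fg]
  exact hfg

/-- A finitely generated abelian group has only finitely many elements of finite order. -/
theorem CommGroup.finite_torsion_of_fg (G : Type*) [CommGroup G] [Group.FG G] :
    Finite (CommGroup.torsion G) := by
  have := CommGroup.fg_subgroup (CommGroup.torsion G)
  exact CommGroup.finite_of_fg_isMulTorsion _ (CommMonoid.torsion.isMulTorsion (G := G))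

/-- Under a `ℚ`-surjective map and finite kernel, an element whose image lies in `g₁.range` has
a positive power in `f₁.range`. -/
theorem QSurjective.exists_pow_mem_range {A₁ A₂ B₁ B₂ : Type*} [Group A₁] [CommGroup A₂]
    [Group B₁] [Group B₂] {f₁ : A₁ →* A₂} {g₁ : B₁ →* B₂} {ℓ₁ : A₁ →* B₁} {ℓ₂ : A₂ →* B₂}
    (hQ : QSurjective ℓ₁) (hcomm : ℓ₂.comp f₁ = g₁.comp ℓ₁) (hker : Finite ℓ₂.ker)
    {x : A₂} (hx : ℓ₂ x ∈ g₁.range) : ∃ n : ℕ, 0 < n ∧ x ^ n ∈ f₁.range := by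
  obtain ⟨b, hb⟩ := hx
  obtain ⟨n, hn, a, ha⟩ := hQ b
  have hfa : ℓ₂ (f₁ a) = ℓ₂ (x ^ n) := by
    rw [map_pow, ← hb, ← map_pow, ← ha]
    exact DFunLike.congr_fun hcomm a
  have hk : x ^ n / f₁ a ∈ ℓ₂.ker := by
    rw [MonoidHom.mem_ker, map_div, hfa, div_self']
  obtain ⟨m, hm, hpow⟩ := (isOfFinOrder_of_finite (⟨_, hk⟩ : ℓ₂.ker)).exists_pow_eq_one
  have hpow' : (x ^ n / f₁ a) ^ m = 1 := congrArg Subtype.val hpow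
  refine ⟨n * m, Nat.mul_pos hn hm, a ^ m, ?_⟩
  rw [div_pow, div_eq_one] at hpow'
  rw [map_pow, pow_mul, hpow']

theorem stmt0
    {A₁ A₂ B₁ B₂ : Type*} [Group A₁] [CommGroup A₂] [Group B₁] [CommGroup B₂]
    [Group.FG A₂]
    {A₃ B₃ : Type*} [MulAction A₂ A₃] [MulAction B₂ B₃]
    (f₁ : A₁ →* A₂) (g₁ : B₁ →* B₂) (ℓ₁ : A₁ →* B₁) (ℓ₂ : A₂ →* B₂)
    (hcomm : ℓ₂.comp f₁ = g₁.comp ℓ₁)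
    (ℓ₃ : A₃ → B₃) (a₃ : A₃)
    (hQ : QSurjective ℓ₁)
    (hker : Finite ℓ₂.ker)
    (hequiv : ∀ (a₂ : A₂) (a : A₃), ℓ₃ (a₂ • a) = ℓ₂ a₂ • ℓ₃ a)
    (hstabA : MulAction.stabilizer A₂ a₃ = f₁.range)
    (hstabB : MulAction.stabilizer B₂ (ℓ₃ a₃) = g₁.range) :
    (MulAction.orbit A₂ a₃ ∩ ℓ₃ ⁻¹' {ℓ₃ a₃}).Finite := by
  have := CommGroup.finite_torsion_of_fg (A₂ ⧸ MulAction.stabilizer A₂ a₃)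
  refine ((Set.toFinite (CommGroup.torsion (A₂ ⧸ MulAction.stabilizer A₂ a₃) : Set _)).image
    (MulAction.ofQuotientStabilizer A₂ a₃)).subset ?_
  rintro _ ⟨⟨x, rfl⟩, hx⟩
  have hx' : ℓ₂ x ∈ g₁.range := by
    rw [← hstabB, MulAction.mem_stabilizer_iff, ← hequiv]
    exact hx
  obtain ⟨n, hn, hpow⟩ := hQ.exists_pow_mem_range hcomm hker hx'
  refine ⟨(x : A₂ ⧸ MulAction.stabilizer A₂ a₃), ?_, rfl⟩
  refine isOfFinOrder_iff_pow_eq_one.mpr ⟨n, hn, ?_⟩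
  rw [← QuotientGroup.mk_pow, QuotientGroup.eq_one_iff, hstabA]
  exact hpow
end

section
/- Let A1, A2, B1, B2 be groups with A2 and B2 abelian and A2 finitely generated. Let A3 be a set with an A2-action, B3 a set with a B2-action, and A4, B4 sets. Let f1 : A1 → A2, g1 : B1 → B2, ℓ1 : A1 → B1, ℓ2 : A2 → B2 be group homomorphisms with ℓ2 ∘ f1 = g1 ∘ ℓ1, and let f3 : A3 → A4, g3 : B3 → B4, ℓ3 : A3 → B3, ℓ4 : A4 → B4 be maps with ℓ4 ∘ f3 = g3 ∘ ℓ3. Assume: (i) ℓ1 is Q-surjective and the kernel of ℓ2 is finite; (ii) ℓ3(a2 · a) = ℓ2(a2) · ℓ3(a) for all a2 ∈ A2 and a ∈ A3; (iii) for every a ∈ A3 the orbit A2 · a equals the fiber f3⁻¹(f3(a)), and for every b ∈ B3 the orbit B2 · b equals the fiber g3⁻¹(g3(b)); (iv) for every a ∈ A3, the stabilizer of a under the A2-action equals the image of f1 and the stabilizer of ℓ3(a) under the B2-action equals the image of g1; (v) ℓ4 is finite-to-one. Then ℓ3 is finite-to-one. -/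
/-- A finitely generated commutative group has only finitely many elements of finite order. -/
theorem finite_setOf_isOfFinOrder_of_fg (G : Type*) [CommGroup G] [Group.FG G] :
    {x : G | IsOfFinOrder x}.Finite := by
  have : Module.Finite ℤ (Additive G) := Module.Finite.iff_addGroup_fg.mpr inferInstance
  have : Finite (Submodule.torsion ℤ (Additive G)) :=
    Module.finite_of_fg_torsion _ Submodule.torsion_isTorsion
  refine ((Set.toFinite (Submodule.torsion ℤ (Additive G) : Set (Additive G))).image
    Additive.toMul).subset fun x hx ↦ ⟨Additive.ofMul x, ?_, rfl⟩
  obtain ⟨n, hn, hxn⟩ := isOfFinOrder_iff_pow_eq_one.mp hx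
  refine (Submodule.mem_torsion_iff _).mpr
    ⟨⟨n, mem_nonZeroDivisors_of_ne_zero (by exact_mod_cast hn.ne')⟩, ?_⟩
  change (n : ℤ) • Additive.ofMul x = 0
  rw [natCast_zsmul, ← ofMul_pow, hxn, ofMul_one]

/-- In a commutative square of groups with `ℚ`-surjective left side and finite kernel on the right,
elements mapping into the range of the bottom map have finite order modulo the range of the top
map. -/
theorem QSurjective.isOfFinOrder_mk {A₁ A₂ B₁ B₂ : Type*} [Group A₁] [CommGroup A₂] [Group B₁]
    [CommGroup B₂] {f₁ : A₁ →* A₂} {g₁ : B₁ →* B₂} {ℓ₁ : A₁ →* B₁} {ℓ₂ : A₂ →* B₂}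
    (hQ : QSurjective ℓ₁) (hcomm : ℓ₂.comp f₁ = g₁.comp ℓ₁) [Finite ℓ₂.ker]
    {x : A₂} (hx : ℓ₂ x ∈ g₁.range) : IsOfFinOrder (x : A₂ ⧸ f₁.range) := by
  obtain ⟨b, hb⟩ := hx
  obtain ⟨n, hn, a, ha⟩ := hQ b
  have hk : x ^ n * (f₁ a)⁻¹ ∈ ℓ₂.ker := by
    rw [MonoidHom.mem_ker, map_mul, map_inv, map_pow, ← hb, ← map_pow, ← ha,
      show ℓ₂ (f₁ a) = g₁ (ℓ₁ a) from DFunLike.congr_fun hcomm a, mul_inv_cancel]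
  have hfin : IsOfFinOrder (x ^ n * (f₁ a)⁻¹) :=
    ℓ₂.ker.subtype.isOfFinOrder (isOfFinOrder_of_finite (⟨_, hk⟩ : ℓ₂.ker))
  have hmk : (QuotientGroup.mk' f₁.range) (x ^ n * (f₁ a)⁻¹) = (x : A₂ ⧸ f₁.range) ^ n := by
    have : (QuotientGroup.mk' f₁.range) (f₁ a) = 1 :=
      (QuotientGroup.eq_one_iff _).mpr ⟨a, rfl⟩
    rw [map_mul, map_inv, this, inv_one, mul_one, map_pow, QuotientGroup.mk'_apply]
  have hpow := (QuotientGroup.mk' f₁.range).isOfFinOrder hfin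
  rw [hmk] at hpow
  exact hpow.of_pow hn.ne'

theorem stmt1
    {A₁ A₂ B₁ B₂ : Type*} [Group A₁] [CommGroup A₂] [Group B₁] [CommGroup B₂]
    [Group.FG A₂]
    {A₃ B₃ A₄ B₄ : Type*} [MulAction A₂ A₃] [MulAction B₂ B₃]
    (f₁ : A₁ →* A₂) (g₁ : B₁ →* B₂) (ℓ₁ : A₁ →* B₁) (ℓ₂ : A₂ →* B₂)
    (hcomm : ℓ₂.comp f₁ = g₁.comp ℓ₁)
    (f₃ : A₃ → A₄) (g₃ : B₃ → B₄) (ℓ₃ : A₃ → B₃) (ℓ₄ : A₄ → B₄)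
    (hcomm' : ℓ₄ ∘ f₃ = g₃ ∘ ℓ₃)
    (hQ : QSurjective ℓ₁)
    (hker : Finite ℓ₂.ker)
    (hequiv : ∀ (a₂ : A₂) (a : A₃), ℓ₃ (a₂ • a) = ℓ₂ a₂ • ℓ₃ a)
    (horbA : ∀ a : A₃, MulAction.orbit A₂ a = f₃ ⁻¹' {f₃ a})
    (horbB : ∀ b : B₃, MulAction.orbit B₂ b = g₃ ⁻¹' {g₃ b})
    (hstabA : ∀ a : A₃, MulAction.stabilizer A₂ a = f₁.range)
    (hstabB : ∀ a : A₃, MulAction.stabilizer B₂ (ℓ₃ a) = g₁.range)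
    (hℓ₄ : ∀ b₄ : B₄, (ℓ₄ ⁻¹' {b₄}).Finite) :
    ∀ b₃ : B₃, (ℓ₃ ⁻¹' {b₃}).Finite := by
  intro b₃
  have hmaps : Set.MapsTo f₃ (ℓ₃ ⁻¹' {b₃}) (ℓ₄ ⁻¹' {g₃ b₃}) := fun a ha ↦
    (congr_fun hcomm' a).trans (congr_arg g₃ ha)
  refine Set.Finite.of_finite_fibers f₃ ((hℓ₄ (g₃ b₃)).subset hmaps.image_subset) ?_
  rintro _ ⟨a, rfl, rfl⟩
  refine ((finite_setOf_isOfFinOrder_of_fg (A₂ ⧸ f₁.range)).image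
    fun q ↦ q.out • a).subset ?_
  rintro y ⟨hy, hya⟩
  obtain ⟨x, rfl⟩ : y ∈ MulAction.orbit A₂ a := horbA a ▸ hya
  have hx : ℓ₂ x ∈ g₁.range := by
    rw [← hstabB a, MulAction.mem_stabilizer_iff, ← hequiv]
    exact hy
  refine ⟨x, hQ.isOfFinOrder_mk hcomm hx, ?_⟩
  obtain ⟨⟨r, hr⟩, hout⟩ := QuotientGroup.mk_out_eq_mul f₁.range x
  rw [← hstabA a, MulAction.mem_stabilizer_iff] at hr
  change (x : A₂ ⧸ f₁.range).out • a = x • a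
  rw [hout, mul_smul, hr]
end

section
/- Let p be an odd prime and let (ε_i)_{i≥1} be the unique sequence of rational numbers satisfying, for every integer l ≥ 1, 1/(2l+1)! = Σ_{i=1}^{l} Σ_{j_1+⋯+j_i=l, j_t≥1} 2^i ε_i / ((2j_1)! ⋯ (2j_i)!). Then for every i with 1 ≤ i ≤ (p−3)/2, the rational number ε_i lies in Z_(p). -/
open Finset in
/-- The defining system of equations for the sequence `(ε_i)_{i ≥ 1}`:
for every `l ≥ 1`,
`1/(2l+1)! = ∑_{i=1}^{l} ∑_{j₁+⋯+jᵢ=l, jₜ≥1} 2^i ε_i / ((2j₁)! ⋯ (2jᵢ)!)`,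
where the inner sum is over tuples of positive integers summing to `l`. -/
def IsEpsilonSeq (ε : ℕ → ℚ) : Prop :=
  ∀ l : ℕ, 1 ≤ l →
    (1 : ℚ) / (Nat.factorial (2 * l + 1) : ℚ) =
      ∑ i ∈ Finset.Icc 1 l,
        ∑ j ∈ (Finset.Nat.antidiagonalTuple i l).filter (fun j => ∀ t, 1 ≤ j t),
          (2 : ℚ) ^ i * ε i / ∏ t, (Nat.factorial (2 * j t) : ℚ)


/-- `x ∈ ℤ_(p)`: the denominator of `x` in lowest terms is not divisible by `p`. -/
def InZLoc (p : ℕ) (x : ℚ) : Prop := ¬ (p : ℕ) ∣ x.den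

/-- The localization `ℤ_(p)`, as the valuation subring of the `p`-adic valuation on `ℚ`. -/
def zLoc (p : ℕ) [Fact p.Prime] : ValuationSubring ℚ :=
  (Rat.padicValuation p).valuationSubring

theorem mem_zLoc_iff {p : ℕ} [Fact p.Prime] {x : ℚ} : x ∈ zLoc p ↔ InZLoc p x := by
  rw [zLoc, Valuation.mem_valuationSubring_iff, Rat.padicValuation_le_one_iff, InZLoc]

theorem inv_natCast_mem_zLoc {p : ℕ} [Fact p.Prime] {n : ℕ} (h : ¬ p ∣ n) :
    (n : ℚ)⁻¹ ∈ zLoc p := by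
  rw [mem_zLoc_iff, InZLoc, Rat.inv_natCast_den_of_pos (Nat.pos_of_ne_zero (by aesop))]
  exact h

theorem inv_factorial_mem_zLoc {p : ℕ} [hp : Fact p.Prime] {n : ℕ} (h : n < p) :
    (Nat.factorial n : ℚ)⁻¹ ∈ zLoc p :=
  inv_natCast_mem_zLoc (by rw [hp.out.dvd_factorial]; omega)

/-- The only composition of `l` into `l` positive parts is `(1, …, 1)`. -/
theorem filter_antidiagonalTuple_self (l : ℕ) :
    (Finset.Nat.antidiagonalTuple l l).filter (fun j => ∀ t, 1 ≤ j t) = {fun _ => 1} := by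
  ext j
  simp only [Finset.mem_filter, Finset.Nat.mem_antidiagonalTuple, Finset.mem_singleton]
  constructor
  · rintro ⟨hs, hj⟩
    have h := (Finset.sum_eq_sum_iff_of_le (s := Finset.univ) (f := fun _ : Fin l => 1)
      (g := j) (fun t _ => hj t)).1 (by simp [hs])
    exact funext fun t => (h t (Finset.mem_univ t)).symm
  · rintro rfl
    simp

theorem stmt5 (p : ℕ) (hp : p.Prime) (hodd : Odd p)
    (ε : ℕ → ℚ) (hε : IsEpsilonSeq ε) :
    ∀ i : ℕ, 1 ≤ i → i ≤ (p - 3) / 2 → InZLoc p (ε i) := by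
  have := Fact.mk hp
  intro l
  induction l using Nat.strong_induction_on with
  | _ l ih =>
    intro hl hlp
    have h := hε l hl
    rw [← Finset.Ico_insert_right hl, Finset.sum_insert (by simp),
      filter_antidiagonalTuple_self, Finset.sum_singleton] at h
    simp only [mul_one, Nat.factorial_two, Finset.prod_const, Finset.card_univ,
      Fintype.card_fin, Nat.cast_ofNat] at h
    rw [mul_div_cancel_left₀ _ (by positivity), ← sub_eq_iff_eq_add] at h
    rw [← mem_zLoc_iff, ← h, one_div]
    refine sub_mem (inv_factorial_mem_zLoc (by omega)) (sum_mem fun i hi => sum_mem fun j hj => ?_)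
    rw [Finset.mem_Ico] at hi
    rw [Finset.mem_filter, Finset.Nat.mem_antidiagonalTuple] at hj
    rw [div_eq_mul_inv, ← Finset.prod_inv_distrib]
    refine mul_mem (mul_mem (pow_mem (ofNat_mem _ 2) i)
      (mem_zLoc_iff.2 (ih i hi.2 hi.1 (by omega)))) (prod_mem fun t _ => inv_factorial_mem_zLoc ?_)
    have : j t ≤ l := hj.1 ▸ Finset.single_le_sum (fun _ _ => Nat.zero_le _) (Finset.mem_univ t)
    omega
end

section
/- Let p be a prime with p ≥ 5 and let (ε_i)_{i≥1} be the unique sequence of rational numbers satisfying, for every integer l ≥ 1, 1/(2l+1)! = Σ_{i=1}^{l} Σ_{j_1+⋯+j_i=l, j_t≥1} 2^i ε_i / ((2j_1)! ⋯ (2j_i)!). Then for every i with (p+1)/2 ≤ i ≤ p−3, the rational number p·ε_i lies in Z_(p). -/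
section ZLoc

variable {p : ℕ}

lemma inZLoc_mul (hp : p.Prime) {x y : ℚ} (hx : InZLoc p x) (hy : InZLoc p y) :
    InZLoc p (x * y) := fun h =>
  ((Nat.Prime.dvd_mul hp).1 (h.trans (Rat.mul_den_dvd x y))).elim hx hy

lemma inZLoc_add (hp : p.Prime) {x y : ℚ} (hx : InZLoc p x) (hy : InZLoc p y) :
    InZLoc p (x + y) := fun h =>
  ((Nat.Prime.dvd_mul hp).1 (h.trans (Rat.add_den_dvd x y))).elim hx hy

lemma inZLoc_intCast (hp : p.Prime) (n : ℤ) : InZLoc p (n : ℚ) := by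
  simpa [InZLoc] using hp.one_lt.ne'

lemma inZLoc_neg {x : ℚ} (hx : InZLoc p x) : InZLoc p (-x) := by
  simpa [InZLoc] using hx

lemma inZLoc_sum (hp : p.Prime) {ι : Type*} (s : Finset ι) (f : ι → ℚ)
    (h : ∀ i ∈ s, InZLoc p (f i)) : InZLoc p (∑ i ∈ s, f i) :=
  Finset.sum_induction f (InZLoc p) (fun _ _ => inZLoc_add hp)
    (by simpa using inZLoc_intCast hp 0) h

lemma inZLoc_intCast_div {n : ℕ} (h : ¬ p ∣ n) (m : ℤ) : InZLoc p ((m : ℚ) / n) := fun hd => by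
  have hn := Rat.den_dvd m n
  rw [Rat.divInt_eq_div] at hn
  exact h (Int.natCast_dvd_natCast.1 ((Int.natCast_dvd_natCast.2 hd).trans (by exact_mod_cast hn)))

lemma exists_factorial_eq_prime_mul (hp : p.Prime) {n : ℕ} (h₁ : p ≤ n) (h₂ : n < 2 * p) :
    ∃ m, n.factorial = p * m ∧ ¬ p ∣ m := by
  obtain ⟨r, rfl⟩ := Nat.exists_eq_add_of_le h₁
  refine ⟨(p - 1).factorial * (p + 1).ascFactorial r, ?_, fun h => ?_⟩
  · rw [← mul_assoc, Nat.mul_factorial_pred hp.ne_zero, Nat.factorial_mul_ascFactorial]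
  · rcases hp.dvd_mul.1 h with h | h
    · have := (hp.dvd_factorial).1 h
      have := hp.pos
      omega
    · rw [Nat.ascFactorial_eq_prod_range, Prime.dvd_finsetProd_iff hp.prime] at h
      obtain ⟨i, hi, hd⟩ := h
      rw [add_assoc, Nat.dvd_add_right dvd_rfl] at hd
      have := Nat.le_of_dvd (by omega) hd
      have := Finset.mem_range.1 hi
      omega

end ZLoc

namespace EpsilonSeq

open PowerSeries

/-- The power series of `sinh √X / √X`. -/
noncomputable def sinhSeries : ℚ⟦X⟧ := mk fun n => 1 / (Nat.factorial (2 * n + 1) : ℚ)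

/-- The power series of `cosh √X - 1`. -/
noncomputable def coshSubOne : ℚ⟦X⟧ :=
  mk fun n => if n = 0 then 0 else 1 / (Nat.factorial (2 * n) : ℚ)

/-- The coefficients of `x / sinh x` as a power series in `2 (cosh x - 1)`. -/
def invCoeff (n : ℕ) : ℚ :=
  (((-1) ^ n * (Nat.factorial n : ℤ) ^ 2 : ℤ) : ℚ) / (Nat.factorial (2 * n + 1) : ℕ)

lemma constantCoeff_two_mul_coshSubOne : constantCoeff (2 * coshSubOne) = 0 := by
  simp [coshSubOne]

lemma hasSubst_two_mul_coshSubOne : HasSubst (2 * coshSubOne) :=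
  HasSubst.of_constantCoeff_zero' constantCoeff_two_mul_coshSubOne

lemma coeff_two_mul (f : ℚ⟦X⟧) (n : ℕ) : coeff n (2 * f) = 2 * coeff n f := by
  rw [two_mul, map_add, two_mul]

lemma derivative_two_mul_coshSubOne : d⁄dX ℚ (2 * coshSubOne) = sinhSeries := by
  ext n
  rw [coeff_derivative, coeff_two_mul]
  simp only [coshSubOne, sinhSeries, coeff_mk, Nat.add_one_ne_zero, if_false]
  rw [show 2 * (n + 1) = 2 * n + 1 + 1 by ring, Nat.factorial_succ (2 * n + 1)]
  push_cast
  field_simp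
  ring

lemma sinhSeries_add_derivative :
    sinhSeries + 2 * (X * d⁄dX ℚ sinhSeries) = 1 + coshSubOne := by
  ext n
  rw [map_add, map_add, coeff_two_mul]
  rcases n with _ | n
  · simp [sinhSeries, coshSubOne]
  · rw [coeff_succ_X_mul, coeff_derivative]
    simp only [coshSubOne, sinhSeries, coeff_mk, Nat.add_one_ne_zero, if_false, coeff_one]
    rw [Nat.factorial_succ (2 * (n + 1))]
    push_cast
    field_simp
    ring

lemma coshSubOne_mul_add_two :
    2 * coshSubOne * (2 * coshSubOne + 4) = 4 * (X * sinhSeries ^ 2) := by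
  apply derivative.ext
  · have h4 : d⁄dX ℚ (4 : ℚ⟦X⟧) = 0 := by
      exact_mod_cast Derivation.map_natCast (d⁄dX ℚ) 4
    rw [Derivation.leibniz, map_add, derivative_two_mul_coshSubOne, Derivation.leibniz,
      Derivation.leibniz, derivative_pow, h4, derivative_X]
    simp only [smul_eq_mul]
    push_cast
    linear_combination (-4 * sinhSeries) * sinhSeries_add_derivative
  · simp [coshSubOne]

lemma invCoeff_succ (n : ℕ) : (n + 1 : ℚ) * invCoeff n + (4 * n + 6) * invCoeff (n + 1) = 0 := by
  unfold invCoeff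
  rw [show 2 * (n + 1) + 1 = 2 * n + 1 + 1 + 1 by ring, Nat.factorial_succ (2 * n + 1 + 1),
    Nat.factorial_succ (2 * n + 1), Nat.factorial_succ n]
  push_cast
  field_simp
  ring

lemma mk_invCoeff_ode :
    X * (X + 4) * d⁄dX ℚ (mk invCoeff) + (X + 2) * mk invCoeff = 2 := by
  have : X * (X + 4) * d⁄dX ℚ (mk invCoeff) + (X + 2) * mk invCoeff =
      X * (X * d⁄dX ℚ (mk invCoeff) + 2 * (2 * d⁄dX ℚ (mk invCoeff)) + mk invCoeff)
        + 2 * mk invCoeff := by ring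
  rw [this]
  ext n
  rw [map_add, coeff_two_mul, show (2 : ℚ⟦X⟧) = 2 * 1 by ring, coeff_two_mul (1 : ℚ⟦X⟧)]
  rcases n with _ | n
  · simp [invCoeff]
  · rw [coeff_succ_X_mul, map_add, map_add, ← show (2 : ℚ⟦X⟧) = 2 * 1 by ring, coeff_two_mul,
      coeff_two_mul, coeff_derivative, coeff_mk, coeff_mk, coeff_one, if_neg n.succ_ne_zero]
    have h := invCoeff_succ n
    rcases n with _ | n
    · simp at h ⊢
      linarith
    · rw [coeff_succ_X_mul, coeff_derivative, coeff_mk]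
      push_cast at h ⊢
      linear_combination h

lemma sinhSeries_mul_subst_mk_invCoeff :
    sinhSeries * (mk invCoeff).subst (2 * coshSubOne) = 1 := by
  have hw := hasSubst_two_mul_coshSubOne
  have hode := congrArg (substAlgHom hw) mk_invCoeff_ode
  simp only [map_add, map_mul, map_ofNat, substAlgHom_X] at hode
  simp only [coe_substAlgHom] at hode
  have hd := derivative_subst (f := mk invCoeff) hw
  rw [derivative_two_mul_coshSubOne] at hd
  set A := (mk invCoeff).subst (2 * coshSubOne) with hA
  set A' := (d⁄dX ℚ (mk invCoeff)).subst (2 * coshSubOne) with hA'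
  have key : sinhSeries * A + 2 * (X * d⁄dX ℚ (sinhSeries * A)) = 1 := by
    rw [Derivation.leibniz, hd]
    simp only [smul_eq_mul]
    have h2 : (2 : ℚ⟦X⟧) ≠ 0 := fun h => by
      have h' := congrArg (constantCoeff (R := ℚ)) h
      rw [map_ofNat, map_zero] at h'
      exact two_ne_zero h'
    apply mul_left_cancel₀ h2
    linear_combination hode + (2 * A) * sinhSeries_add_derivative - A' * coshSubOne_mul_add_two
  ext n
  have hn := congrArg (coeff n) key
  rw [map_add, coeff_two_mul] at hn
  rcases n with _ | n
  · simpa using hn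
  · rw [coeff_succ_X_mul, coeff_derivative] at hn
    simp only [coeff_one, Nat.add_one_ne_zero, if_false] at hn ⊢
    have h0 : (coeff (n + 1) (sinhSeries * A)) * (2 * n + 3) = 0 := by linear_combination hn
    exact (mul_eq_zero.1 h0).resolve_right (by positivity)

/-- Substituting a series with zero constant and invertible linear coefficient is injective. -/
lemma eq_one_of_subst_eq_one {F w : ℚ⟦X⟧} (h0 : constantCoeff w = 0) (h1 : coeff 1 w ≠ 0)
    (h : F.subst w = 1) : F = 1 := by
  have hu : IsUnit (coeff 1 w) := h1.isUnit
  have hv := HasSubst.substInvOfIsUnit w hu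
  have hone : (1 : ℚ⟦X⟧).subst (w.substInvOfIsUnit hu) = (1 : ℚ⟦X⟧) := by
    rw [← coe_substAlgHom hv, map_one]
  rw [← X_subst F, ← subst_substInvOfIsUnit_right w h0 hu,
    ← subst_comp_subst_apply (HasSubst.of_constantCoeff_zero' h0) hv, h, hone]

lemma coeff_pow_eq_sum_antidiagonalTuple (f : ℚ⟦X⟧) (i l : ℕ) :
    coeff l (f ^ i) = ∑ j ∈ Finset.Nat.antidiagonalTuple i l, ∏ t, coeff (j t) f := by
  have : f ^ i = ∏ _t : Fin i, f := by simp
  rw [this, coeff_prod]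
  refine Finset.sum_bij (fun j _ => ⇑j) (fun j hj => ?_) (fun _ _ _ _ h => DFunLike.coe_injective h)
    (fun j hj => ⟨Finsupp.equivFunOnFinite.symm j, ?_, ?_⟩) (fun _ _ => rfl)
  · simpa [Finset.Nat.mem_antidiagonalTuple] using hj
  · simpa [Finset.Nat.mem_antidiagonalTuple] using hj
  · rfl

lemma sum_filter_antidiagonalTuple (c : ℚ) (i l : ℕ) :
    ∑ j ∈ (Finset.Nat.antidiagonalTuple i l).filter (fun j => ∀ t, 1 ≤ j t),
      (2 : ℚ) ^ i * c / ∏ t, (Nat.factorial (2 * j t) : ℚ) =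
    c * coeff l ((2 * coshSubOne) ^ i) := by
  have h2 : (2 * coshSubOne) ^ i = (2 : ℚ) ^ i • coshSubOne ^ i := by
    rw [mul_pow, smul_eq_C_mul, map_pow, map_ofNat]
  rw [h2, map_smul, coeff_pow_eq_sum_antidiagonalTuple, smul_eq_mul, ← mul_assoc, Finset.mul_sum,
    Finset.sum_filter]
  refine Finset.sum_congr rfl fun j _ => ?_
  split_ifs with h
  · have : ∀ t, coeff (j t) coshSubOne = 1 / (Nat.factorial (2 * j t) : ℚ) := fun t => by
      have := h t
      rw [coshSubOne, coeff_mk, if_neg (by omega)]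
    simp only [this, Finset.prod_div_distrib, Finset.prod_const_one]
    ring
  · push Not at h
    obtain ⟨t, ht⟩ := h
    rw [Finset.prod_eq_zero (Finset.mem_univ t), mul_zero]
    rw [coshSubOne, coeff_mk, if_pos (by omega)]

/-- The generating series of `ε`, with constant coefficient `1`. -/
noncomputable def genSeries (ε : ℕ → ℚ) : ℚ⟦X⟧ := mk fun i => if i = 0 then 1 else ε i

lemma subst_genSeries {ε : ℕ → ℚ} (hε : IsEpsilonSeq ε) :
    (genSeries ε).subst (2 * coshSubOne) = sinhSeries := by
  ext l
  rw [coeff_subst' hasSubst_two_mul_coshSubOne,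
    finsum_eq_sum_of_support_subset (s := Finset.range (l + 1))]
  · rw [Finset.sum_range_succ']
    rcases Nat.eq_zero_or_pos l with rfl | hl
    · simp [genSeries, sinhSeries]
    · have h := hε l hl
      simp only [sum_filter_antidiagonalTuple] at h
      rw [sinhSeries, coeff_mk, h, pow_zero, coeff_one, if_neg hl.ne', smul_zero, add_zero,
        ← Finset.Ico_add_one_right_eq_Icc, Finset.sum_Ico_eq_sum_range, Nat.add_sub_cancel]
      refine Finset.sum_congr rfl fun d _ => ?_
      rw [genSeries, coeff_mk, if_neg d.succ_ne_zero, smul_eq_mul, add_comm 1 d]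
  · intro d hd
    by_contra hdl
    refine hd ?_
    have hdvd : X ^ d ∣ (2 * coshSubOne) ^ d :=
      pow_dvd_pow_of_dvd (X_dvd_iff.2 constantCoeff_two_mul_coshSubOne) d
    simp only [Finset.coe_range, Set.mem_Iio, not_lt] at hdl
    simp only [X_pow_dvd_iff.1 hdvd l (by omega), smul_zero]

lemma mk_invCoeff_mul_genSeries {ε : ℕ → ℚ} (hε : IsEpsilonSeq ε) :
    mk invCoeff * genSeries ε = 1 := by
  refine eq_one_of_subst_eq_one constantCoeff_two_mul_coshSubOne ?_ ?_
  · rw [coeff_two_mul]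
    simp [coshSubOne]
  · rw [subst_mul hasSubst_two_mul_coshSubOne, subst_genSeries hε, mul_comm,
      sinhSeries_mul_subst_mk_invCoeff]

lemma coeff_genSeries_eq {ε : ℕ → ℚ} (hε : IsEpsilonSeq ε) {n : ℕ} (hn : n ≠ 0) :
    coeff n (genSeries ε) =
      -∑ k ∈ Finset.range n, invCoeff (k + 1) * coeff (n - (k + 1)) (genSeries ε) := by
  have h := congrArg (coeff n) (mk_invCoeff_mul_genSeries hε)
  rw [coeff_mul, Finset.Nat.sum_antidiagonal_eq_sum_range_succ
    (fun i j => coeff i (mk invCoeff) * coeff j (genSeries ε)), Finset.sum_range_succ'] at h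
  simp only [coeff_mk, coeff_one, hn, if_false, Nat.sub_zero] at h
  have h0 : invCoeff 0 = 1 := by simp [invCoeff]
  rw [h0] at h
  linarith

variable {p : ℕ}

lemma inZLoc_invCoeff (hp : p.Prime) {k : ℕ} (hk : 2 * k + 1 < p) : InZLoc p (invCoeff k) :=
  inZLoc_intCast_div (fun h => by have := hp.dvd_factorial.1 h; omega) _

lemma inZLoc_prime_mul_invCoeff (hp : p.Prime) {k : ℕ} (hk : k < p) :
    InZLoc p (p * invCoeff k) := by
  rcases lt_or_ge (2 * k + 1) p with h | h
  · exact inZLoc_mul hp (by simpa using inZLoc_intCast hp p) (inZLoc_invCoeff hp h)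
  · obtain ⟨m, hm, hpm⟩ := exists_factorial_eq_prime_mul hp h (by omega)
    have hp0 : (p : ℚ) ≠ 0 := Nat.cast_ne_zero.2 hp.ne_zero
    rw [invCoeff, hm, Nat.cast_mul, ← mul_div_assoc, mul_div_mul_left _ _ hp0]
    exact inZLoc_intCast_div hpm _

lemma inZLoc_coeff_genSeries (hp : p.Prime) {ε : ℕ → ℚ} (hε : IsEpsilonSeq ε) {n : ℕ}
    (hn : 2 * n + 1 < p) : InZLoc p (coeff n (genSeries ε)) := by
  induction n using Nat.strong_induction_on with
  | _ n ih =>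
    rcases eq_or_ne n 0 with rfl | hn0
    · simpa [genSeries] using inZLoc_intCast hp 1
    · rw [coeff_genSeries_eq hε hn0]
      refine inZLoc_neg (inZLoc_sum hp _ _ fun k hk => ?_)
      have := Finset.mem_range.1 hk
      exact inZLoc_mul hp (inZLoc_invCoeff hp (by omega)) (ih _ (by omega) (by omega))

lemma inZLoc_prime_mul_coeff_genSeries (hp : p.Prime) {ε : ℕ → ℚ} (hε : IsEpsilonSeq ε) {n : ℕ}
    (hn : n + 1 < p) : InZLoc p (p * coeff n (genSeries ε)) := by
  induction n using Nat.strong_induction_on with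
  | _ n ih =>
    rcases eq_or_ne n 0 with rfl | hn0
    · simpa [genSeries] using inZLoc_intCast hp p
    · rw [coeff_genSeries_eq hε hn0, mul_neg, Finset.mul_sum]
      refine inZLoc_neg (inZLoc_sum hp _ _ fun k hk => ?_)
      have := Finset.mem_range.1 hk
      rcases lt_or_ge (2 * (k + 1) + 1) p with h | h
      · rw [mul_left_comm]
        exact inZLoc_mul hp (inZLoc_invCoeff hp h) (ih _ (by omega) (by omega))
      · rw [← mul_assoc]
        exact inZLoc_mul hp (inZLoc_prime_mul_invCoeff hp (by omega))
          (inZLoc_coeff_genSeries hp hε (by omega))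

end EpsilonSeq

theorem stmt7 (p : ℕ) (hp : p.Prime) (hp5 : 5 ≤ p)
    (ε : ℕ → ℚ) (hε : IsEpsilonSeq ε) :
    ∀ i : ℕ, (p + 1) / 2 ≤ i → i ≤ p - 3 → InZLoc p ((p : ℚ) * ε i) := by
  intro i hi hi'
  have h := EpsilonSeq.inZLoc_prime_mul_coeff_genSeries hp hε (n := i) (by omega)
  rwa [EpsilonSeq.genSeries, PowerSeries.coeff_mk, if_neg (by omega)] at h
end

section
/- Let p be an odd prime and let (ε_i)_{i≥1} be the unique sequence of rational numbers satisfying, for every integer l ≥ 1, 1/(2l+1)! = Σ_{i=1}^{l} Σ_{j_1+⋯+j_i=l, j_t≥1} 2^i ε_i / ((2j_1)! ⋯ (2j_i)!). If k is an integer such that k·ε_{p−1} lies in Z_(p), then p² divides k. -/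
open PowerSeries in
/-- The series `∑ t^l / (2l+1)!`, that is `sinh √t / √t`. -/
noncomputable def sinhcSeries : ℚ⟦X⟧ := PowerSeries.mk fun l => 1 / ((2 * l + 1).factorial : ℚ)

open PowerSeries in
/-- The series `∑ t^l / (2l)!`, that is `cosh √t`. -/
noncomputable def coshSqrtSeries : ℚ⟦X⟧ := PowerSeries.mk fun l => 1 / ((2 * l).factorial : ℚ)

open PowerSeries in
/-- The series `2 (cosh √t - 1)`. -/
noncomputable def twoCoshSubOne : ℚ⟦X⟧ := 2 * (coshSqrtSeries - 1)

/-- Coefficients of the reciprocal of the generating function of `ε`. -/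
noncomputable def invCoeff (n : ℕ) : ℚ :=
  (-1) ^ n * (n.factorial : ℚ) ^ 2 / ((2 * n + 1).factorial : ℚ)

open PowerSeries in
/-- The power series with coefficients `invCoeff`. -/
noncomputable def invSeries : ℚ⟦X⟧ := PowerSeries.mk invCoeff

namespace PowerSeries

theorem coeff_pow_eq_sum_antidiagonalTuple {R : Type*} [CommSemiring R] (φ : R⟦X⟧) (k n : ℕ) :
    coeff n (φ ^ k) = ∑ j ∈ Finset.Nat.antidiagonalTuple k n, ∏ t, coeff (j t) φ := by
  have h : φ ^ k = ∏ _t : Fin k, φ := by simp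
  rw [h, coeff_prod]
  refine Finset.sum_nbij (fun l => ⇑l) ?_ ?_ ?_ ?_
  · intro l hl
    simpa [Finset.Nat.mem_antidiagonalTuple] using hl
  · exact DFunLike.coe_injective.injOn
  · intro j hj
    refine ⟨Finsupp.equivFunOnFinite.symm j, ?_, ?_⟩
    · simpa [Finset.Nat.mem_antidiagonalTuple] using hj
    · simp
  · intro l _
    rfl

theorem coeff_pow_eq_zero_of_lt {R : Type*} [CommSemiring R] {φ : R⟦X⟧}
    (hφ : constantCoeff φ = 0) {l d : ℕ} (h : l < d) : coeff l (φ ^ d) = 0 := by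
  have h1 : X ^ d ∣ φ ^ d := pow_dvd_pow_of_dvd (X_dvd_iff.mpr hφ) d
  exact X_pow_dvd_iff.mp h1 l h

theorem coeff_subst_eq_sum_range {R : Type*} [CommRing R] {φ : R⟦X⟧}
    (hφ : constantCoeff φ = 0) (f : R⟦X⟧) (l : ℕ) :
    coeff l (f.subst φ) = ∑ d ∈ Finset.range (l + 1), coeff d f * coeff l (φ ^ d) := by
  rw [coeff_subst' (HasSubst.of_constantCoeff_zero' hφ)]
  rw [finsum_eq_sum_of_support_subset (s := Finset.range (l + 1))]
  · simp
  · intro d hd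
    simp only [Finset.coe_range, Set.mem_Iio]
    by_contra hlt
    exact hd (by simp [coeff_pow_eq_zero_of_lt hφ (show l < d by lia)])

theorem eq_zero_of_subst_eq_zero {R : Type*} [CommRing R] [IsDomain R] {φ : R⟦X⟧}
    (hφ : constantCoeff φ = 0) (hφ0 : φ ≠ 0) {f : R⟦X⟧} (hf : f.subst φ = 0) : f = 0 := by
  by_contra hne
  have hs := HasSubst.of_constantCoeff_zero' hφ
  obtain ⟨g, hg⟩ := X_pow_order_dvd (φ := f)
  have hg0 : constantCoeff g ≠ 0 := by
    intro h0
    obtain ⟨g', rfl⟩ := X_dvd_iff.mpr h0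
    have hX : X ^ (f.order.toNat + 1) ∣ f := ⟨g', by rw [pow_succ, mul_assoc]; exact hg⟩
    exact coeff_order (φ := f) hne (X_pow_dvd_iff.mp hX _ (Nat.lt_succ_self _))
  rw [hg, subst_mul hs, subst_pow hs, subst_X hs] at hf
  rcases mul_eq_zero.mp hf with h | h
  · exact hφ0 (eq_zero_of_pow_eq_zero h)
  · have := coeff_subst_eq_sum_range hφ g 0
    rw [h] at this
    simp at this
    exact hg0 this.symm

end PowerSeries

open PowerSeries

theorem derivative_coshSqrtSeries : 2 * d⁄dX ℚ coshSqrtSeries = sinhcSeries := by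
  ext n
  rw [← map_ofNat (C (R := ℚ)) 2, coeff_C_mul, coeff_derivative]
  simp only [coshSqrtSeries, sinhcSeries, coeff_mk]
  rw [show 2 * (n + 1) = (2 * n + 1) + 1 by ring, Nat.factorial_succ (2 * n + 1)]
  have := Nat.factorial_ne_zero (2 * n + 1)
  push_cast
  field_simp
  ring

theorem sinhcSeries_add_derivative :
    sinhcSeries + 2 * (X * d⁄dX ℚ sinhcSeries) = coshSqrtSeries := by
  ext n
  rw [← map_ofNat (C (R := ℚ)) 2, map_add, coeff_C_mul]
  rcases n with _ | n
  · simp [coshSqrtSeries, sinhcSeries]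
  · rw [coeff_succ_X_mul, coeff_derivative]
    simp only [coshSqrtSeries, sinhcSeries, coeff_mk]
    rw [Nat.factorial_succ (2 * (n + 1))]
    have := Nat.factorial_ne_zero (2 * (n + 1))
    push_cast
    field_simp
    ring

theorem coshSqrtSeries_sq_sub : coshSqrtSeries ^ 2 - X * sinhcSeries ^ 2 = 1 := by
  apply derivative.ext
  · have h1 := derivative_coshSqrtSeries
    have h2 := sinhcSeries_add_derivative
    simp only [map_sub, Derivation.leibniz, derivative_pow, derivative_X, derivative_one, smul_eq_mul]
    push_cast
    linear_combination coshSqrtSeries * h1 - sinhcSeries * h2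
  · simp [coshSqrtSeries]

theorem constantCoeff_twoCoshSubOne : constantCoeff twoCoshSubOne = 0 := by
  simp [twoCoshSubOne, coshSqrtSeries]

theorem coeff_twoCoshSubOne {j : ℕ} (hj : 1 ≤ j) :
    coeff j twoCoshSubOne = 2 / ((2 * j).factorial : ℚ) := by
  rw [twoCoshSubOne, ← map_ofNat (C (R := ℚ)) 2, coeff_C_mul]
  simp [coshSqrtSeries, coeff_one, show j ≠ 0 by lia, div_eq_mul_inv]

theorem twoCoshSubOne_ne_zero : twoCoshSubOne ≠ 0 := by
  intro h
  have := coeff_twoCoshSubOne (le_refl 1)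
  rw [h] at this
  norm_num at this

theorem invCoeff_succ (n : ℕ) : 2 * (2 * n + 3) * invCoeff (n + 1) + (n + 1) * invCoeff n = 0 := by
  simp only [invCoeff]
  rw [show 2 * (n + 1) + 1 = (2 * n + 1) + 1 + 1 by ring, Nat.factorial_succ (2 * n + 1 + 1),
    Nat.factorial_succ (2 * n + 1), Nat.factorial_succ n]
  have := Nat.factorial_ne_zero (2 * n + 1)
  push_cast
  field_simp
  ring

theorem invSeries_ode :
    (4 * X + X ^ 2) * d⁄dX ℚ invSeries + (2 + X) * invSeries = 2 := by
  have h : (4 * X + X ^ 2) * d⁄dX ℚ invSeries + (2 + X) * invSeries =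
      C 4 * (X * d⁄dX ℚ invSeries) + X * (X * d⁄dX ℚ invSeries) + C 2 * invSeries
        + X * invSeries := by
    rw [map_ofNat (C (R := ℚ)) 4, map_ofNat (C (R := ℚ)) 2]
    ring
  rw [h]
  ext n
  simp only [map_add, coeff_C_mul]
  rw [← map_ofNat (C (R := ℚ)) 2, coeff_C]
  rcases n with _ | n
  · simp [invSeries, invCoeff]
  · have hrec := invCoeff_succ n
    rw [coeff_succ_X_mul, coeff_succ_X_mul, coeff_succ_X_mul, coeff_derivative]
    rcases n with _ | n
    · simp [invSeries] at hrec ⊢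
      linarith
    · rw [coeff_succ_X_mul, coeff_derivative]
      simp [invSeries] at hrec ⊢
      linarith

theorem eq_one_of_add_two_mul_X_mul_derivative {H : ℚ⟦X⟧}
    (h : H + 2 * (X * d⁄dX ℚ H) = 1) : H = 1 := by
  ext n
  have hn := congrArg (coeff n) h
  rw [← map_ofNat (C (R := ℚ)) 2, map_add, coeff_C_mul] at hn
  rcases n with _ | n
  · simpa using hn
  · rw [coeff_succ_X_mul, coeff_derivative] at hn
    have hpos : (0 : ℚ) < 1 + 2 * (n + 1) := by positivity
    simp only [coeff_one, Nat.succ_ne_zero, if_false] at hn ⊢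
    have : coeff (n + 1) H * (1 + 2 * (n + 1)) = 0 := by linarith
    exact (mul_eq_zero.mp this).resolve_right hpos.ne'

theorem invSeries_subst_mul_sinhcSeries : invSeries.subst twoCoshSubOne * sinhcSeries = 1 := by
  have hs : HasSubst twoCoshSubOne := HasSubst.of_constantCoeff_zero' constantCoeff_twoCoshSubOne
  apply eq_one_of_add_two_mul_X_mul_derivative
  have hc : ∀ a : ℚ, (C a : ℚ⟦X⟧).subst twoCoshSubOne = C a := fun a => by
    rw [subst_C]; rfl
  have hode := congrArg (fun f : ℚ⟦X⟧ => f.subst twoCoshSubOne) invSeries_ode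
  have h2' := hc 2
  have h4' := hc 4
  rw [map_ofNat] at h2' h4'
  simp only [subst_add hs, subst_mul hs, subst_pow hs, subst_X hs, h2', h4'] at hode
  have hv : twoCoshSubOne = 2 * coshSqrtSeries - 2 := by rw [twoCoshSubOne]; ring
  have hdv : d⁄dX ℚ twoCoshSubOne = sinhcSeries := by
    rw [← derivative_coshSqrtSeries, twoCoshSubOne, ← map_ofNat (C (R := ℚ)) 2]
    simp only [Derivation.leibniz, map_sub, derivative_one, derivative_C, smul_eq_mul]
    ring
  rw [Derivation.leibniz, derivative_subst hs, hdv]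
  simp only [smul_eq_mul]
  generalize (subst twoCoshSubOne invSeries : ℚ⟦X⟧) = G at *
  generalize (subst twoCoshSubOne (d⁄dX ℚ invSeries) : ℚ⟦X⟧) = G' at *
  have h2 := sinhcSeries_add_derivative
  have h3 := coshSqrtSeries_sq_sub
  rw [hv] at hode
  have h20 : (2 : ℚ⟦X⟧) ≠ 0 := by
    rw [← map_ofNat (C (R := ℚ)) 2]; simp
  apply mul_left_cancel₀ h20
  linear_combination hode + 2 * G * h2 - 4 * G' * h3

theorem IsEpsilonSeq.subst_eq {ε : ℕ → ℚ} (hε : IsEpsilonSeq ε) :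
    (PowerSeries.mk fun n => if n = 0 then 1 else ε n).subst twoCoshSubOne = sinhcSeries := by
  ext l
  rw [coeff_subst_eq_sum_range constantCoeff_twoCoshSubOne]
  rcases Nat.eq_zero_or_pos l with rfl | hl
  · simp [sinhcSeries]
  rw [sinhcSeries, coeff_mk, hε l hl,
    show Finset.range (l + 1) = insert 0 (Finset.Icc 1 l) by ext; simp; lia,
    Finset.sum_insert (by simp), pow_zero, coeff_one, if_neg hl.ne', mul_zero, zero_add]
  refine Finset.sum_congr rfl fun i hi => ?_
  have hi0 : i ≠ 0 := by rw [Finset.mem_Icc] at hi; lia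
  rw [coeff_mk, if_neg hi0, coeff_pow_eq_sum_antidiagonalTuple, Finset.mul_sum,
    Finset.sum_filter]
  refine Finset.sum_congr rfl fun j _ => ?_
  split_ifs with hj
  · rw [Finset.prod_congr rfl fun t _ => coeff_twoCoshSubOne (hj t), Finset.prod_div_distrib]
    simp
    ring
  · push Not at hj
    obtain ⟨t, ht⟩ := hj
    have h0 : coeff (j t) twoCoshSubOne = 0 := by
      rw [Nat.lt_one_iff.mp ht]
      simpa using constantCoeff_twoCoshSubOne
    rw [Finset.prod_eq_zero (Finset.mem_univ t) h0, mul_zero]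

/-- If `G * F = 1` and `G` has constant coefficient `1`, this computes the coefficients of `F`. -/
theorem PowerSeries.coeff_eq_neg_sum_of_mul_eq_one {R : Type*} [CommRing R] {G F : R⟦X⟧}
    (hGF : G * F = 1) (hG : coeff 0 G = 1) {n : ℕ} (hn : n ≠ 0) :
    coeff n F = -∑ j ∈ Finset.range n, coeff (j + 1) G * coeff (n - (j + 1)) F := by
  have h := congrArg (coeff n) hGF
  rw [coeff_mul, Finset.Nat.sum_antidiagonal_eq_sum_range_succ
    (fun i j => coeff i G * coeff j F), Finset.sum_range_succ', coeff_one, if_neg hn, hG] at h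
  simp only [Nat.sub_zero, one_mul] at h
  exact eq_neg_of_add_eq_zero_right h

section Padic

variable {p : ℕ} [hp : Fact p.Prime]

theorem padicNorm_coeff_eq_sq {m : ℕ} (hm : 1 ≤ m) {G F : ℚ⟦X⟧} (hGF : G * F = 1)
    (hG0 : coeff 0 G = 1) (hG1 : ∀ n < m, padicNorm p (coeff n G) ≤ 1)
    (hGm : padicNorm p (coeff m G) = p) (hG2 : ∀ n ≤ 2 * m, padicNorm p (coeff n G) ≤ p) :
    padicNorm p (coeff (2 * m) F) = p ^ 2 := by
  have hp1 : (1 : ℚ) < p := by exact_mod_cast hp.out.one_lt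
  have hF0 : coeff 0 F = 1 := by
    have h := congrArg constantCoeff hGF
    rw [coeff_zero_eq_constantCoeff_apply] at hG0 ⊢
    rwa [map_mul, hG0, one_mul, map_one] at h
  have hrec := fun n (hn : n ≠ 0) => coeff_eq_neg_sum_of_mul_eq_one hGF hG0 hn
  have hF1 : ∀ n < m, padicNorm p (coeff n F) ≤ 1 := by
    intro n
    induction n using Nat.strong_induction_on with
    | _ n ih =>
      intro hn
      rcases eq_or_ne n 0 with rfl | hn0
      · rw [hF0, padicNorm.one]
      rw [hrec n hn0, padicNorm.neg]
      refine padicNorm.sum_le' (fun j hj => ?_) zero_le_one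
      rw [Finset.mem_range] at hj
      rw [padicNorm.mul]
      exact mul_le_one₀ (hG1 _ (by lia)) (padicNorm.nonneg _) (ih _ (by lia) (by lia))
  have hp0 : (0 : ℚ) ≤ p := by positivity
  have hterm : ∀ i j, i ≤ 2 * m →
      (i < m ∧ padicNorm p (coeff j F) ≤ p) ∨ padicNorm p (coeff j F) ≤ 1 →
      padicNorm p (coeff i G * coeff j F) ≤ p := by
    rintro i j hi (⟨him, hj⟩ | hj)
    · rw [padicNorm.mul]
      exact (mul_le_mul (hG1 i him) hj (padicNorm.nonneg _) zero_le_one).trans_eq (one_mul _)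
    · rw [padicNorm.mul]
      exact (mul_le_mul (hG2 i hi) hj (padicNorm.nonneg _) hp0).trans_eq (mul_one _)
  have hF2 : ∀ n < 2 * m, padicNorm p (coeff n F) ≤ p := by
    intro n
    induction n using Nat.strong_induction_on with
    | _ n ih =>
      intro hn
      rcases eq_or_ne n 0 with rfl | hn0
      · rw [hF0, padicNorm.one]
        exact hp1.le
      rw [hrec n hn0, padicNorm.neg]
      refine padicNorm.sum_le' (fun j hj => ?_) hp0
      rw [Finset.mem_range] at hj
      refine hterm _ _ (by lia) ?_
      by_cases hjm : j + 1 < m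
      · exact Or.inl ⟨hjm, ih _ (by lia) (by lia)⟩
      · exact Or.inr (hF1 _ (by lia))
  have hFm : padicNorm p (coeff m F) = p := by
    obtain ⟨k, rfl⟩ : ∃ k, m = k + 1 := ⟨m - 1, by lia⟩
    rw [hrec (k + 1) (by lia), padicNorm.neg, Finset.sum_range_succ, Nat.sub_self, hF0, mul_one]
    have hrest : padicNorm p (∑ j ∈ Finset.range k,
        coeff (j + 1) G * coeff (k + 1 - (j + 1)) F) ≤ 1 := by
      refine padicNorm.sum_le' (fun j hj => ?_) zero_le_one
      rw [Finset.mem_range] at hj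
      rw [padicNorm.mul]
      exact mul_le_one₀ (hG1 _ (by lia)) (padicNorm.nonneg _) (hF1 _ (by lia))
    rw [padicNorm.add_eq_max_of_ne (by rw [hGm]; exact (hrest.trans_lt hp1).ne), hGm,
      max_eq_right (hrest.trans hp1.le)]
  have hmem : m - 1 ∈ Finset.range (2 * m) := Finset.mem_range.mpr (by lia)
  rw [hrec (2 * m) (by lia), padicNorm.neg, ← Finset.add_sum_erase _ _ hmem,
    show m - 1 + 1 = m by lia, show 2 * m - m = m by lia]
  have hmain : padicNorm p (coeff m G * coeff m F) = (p : ℚ) ^ 2 := by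
    rw [padicNorm.mul, hGm, hFm, sq]
  have hlt : (p : ℚ) < p ^ 2 := by nlinarith
  have hrest : padicNorm p (∑ j ∈ (Finset.range (2 * m)).erase (m - 1),
      coeff (j + 1) G * coeff (2 * m - (j + 1)) F) ≤ p := by
    refine padicNorm.sum_le' (fun j hj => ?_) hp0
    rw [Finset.mem_erase, Finset.mem_range] at hj
    refine hterm _ _ (by lia) ?_
    by_cases hjm : j + 1 < m
    · exact Or.inl ⟨hjm, hF2 _ (by lia)⟩
    · exact Or.inr (hF1 _ (by lia))
  rw [padicNorm.add_eq_max_of_ne (by rw [hmain]; exact (hrest.trans_lt hlt).ne'), hmain,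
    max_eq_left (hrest.trans hlt.le)]

theorem padicNorm_factorial_of_lt {n : ℕ} (hn : n < p) : padicNorm p (n.factorial : ℚ) = 1 := by
  rw [padicNorm.nat_eq_one_iff, hp.out.dvd_factorial]
  lia

theorem padicNorm_factorial_of_le_of_lt {n : ℕ} (hn : p ≤ n) (hn2 : n < 2 * p) :
    padicNorm p (n.factorial : ℚ) = (p : ℚ)⁻¹ := by
  induction n, hn using Nat.le_induction with
  | base =>
    have h1 : p.factorial = p * (p - 1).factorial :=
      (Nat.mul_factorial_pred hp.out.ne_zero).symm
    rw [h1, Nat.cast_mul, padicNorm.mul, padicNorm.padicNorm_p_of_prime,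
      padicNorm_factorial_of_lt (Nat.sub_one_lt hp.out.ne_zero), mul_one]
  | succ n hn ih =>
    have h1 : padicNorm p ((n + 1 : ℕ) : ℚ) = 1 := by
      rw [padicNorm.nat_eq_one_iff]
      rintro ⟨c, hc⟩
      have hc1 : 1 < c := by
        by_contra hle
        have : p * c ≤ p * 1 := Nat.mul_le_mul_left p (by lia)
        lia
      have : p * 2 ≤ p * c := Nat.mul_le_mul_left p hc1
      lia
    rw [Nat.factorial_succ, Nat.cast_mul, padicNorm.mul, h1, one_mul, ih (by lia)]

theorem padicNorm_invCoeff {n : ℕ} (hn : n < p) :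
    padicNorm p (invCoeff n) = (padicNorm p ((2 * n + 1).factorial : ℚ))⁻¹ := by
  rw [invCoeff, padicNorm.div, padicNorm.mul, sq, padicNorm.mul, padicNorm_factorial_of_lt hn]
  rcases neg_one_pow_eq_or ℚ n with h | h <;> simp [h]

end Padic

theorem IsEpsilonSeq.invSeries_mul_eq_one {ε : ℕ → ℚ} (hε : IsEpsilonSeq ε) :
    invSeries * (PowerSeries.mk fun n => if n = 0 then 1 else ε n) = 1 := by
  have hs : HasSubst twoCoshSubOne := HasSubst.of_constantCoeff_zero' constantCoeff_twoCoshSubOne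
  have h1 : (1 : ℚ⟦X⟧).subst twoCoshSubOne = (1 : ℚ⟦X⟧) := by
    rw [← coe_substAlgHom hs, map_one]
  refine sub_eq_zero.mp
    (eq_zero_of_subst_eq_zero constantCoeff_twoCoshSubOne twoCoshSubOne_ne_zero ?_)
  rw [subst_sub hs, subst_mul hs, hε.subst_eq, invSeries_subst_mul_sinhcSeries, h1, sub_self]

theorem IsEpsilonSeq.padicNorm_eq {ε : ℕ → ℚ} (hε : IsEpsilonSeq ε) {p : ℕ} [hp : Fact p.Prime]
    (hodd : Odd p) : padicNorm p (ε (p - 1)) = p ^ 2 := by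
  obtain ⟨m, hm⟩ := hodd
  have hm1 : 1 ≤ m := by
    have := hp.out.two_le
    lia
  have hsmall : ∀ n < m, padicNorm p (invCoeff n) = 1 := fun n hn => by
    rw [padicNorm_invCoeff (by lia), padicNorm_factorial_of_lt (by lia), inv_one]
  have hlarge : ∀ n, m ≤ n → n ≤ 2 * m → padicNorm p (invCoeff n) = p := fun n hn hn2 => by
    rw [padicNorm_invCoeff (by lia), padicNorm_factorial_of_le_of_lt (by lia) (by lia), inv_inv]
  have h := padicNorm_coeff_eq_sq (p := p) hm1 hε.invSeries_mul_eq_one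
    (by simp [invSeries, invCoeff])
    (fun n hn => by rw [invSeries, coeff_mk, hsmall n hn])
    (by rw [invSeries, coeff_mk, hlarge m le_rfl (by lia)])
    (fun n hn => by
      rw [invSeries, coeff_mk]
      rcases lt_or_ge n m with h | h
      · rw [hsmall n h]
        exact_mod_cast hp.out.one_le
      · rw [hlarge n h hn])
  rwa [coeff_mk, if_neg (by lia), show 2 * m = p - 1 by lia] at h

theorem InZLoc.padicNorm_le_one {p : ℕ} [Fact p.Prime] {x : ℚ} (hx : InZLoc p x) :
    padicNorm p x ≤ 1 := by
  rw [← Rat.num_div_den x, padicNorm.div, (padicNorm.nat_eq_one_iff x.den).mpr hx, div_one]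
  exact padicNorm.of_int _

theorem stmt9 (p : ℕ) (hp : p.Prime) (hodd : Odd p)
    (ε : ℕ → ℚ) (hε : IsEpsilonSeq ε) (k : ℤ)
    (hk : InZLoc p ((k : ℚ) * ε (p - 1))) :
    (p : ℤ) ^ 2 ∣ k := by
  have : Fact p.Prime := ⟨hp⟩
  have h := hk.padicNorm_le_one
  rw [padicNorm.mul, hε.padicNorm_eq hodd] at h
  have hp0 : (0 : ℚ) < p ^ 2 := by have := hp.pos; positivity
  have hdvd : ((p ^ 2 : ℕ) : ℤ) ∣ k := by
    rw [padicNorm.dvd_iff_norm_le, zpow_neg, zpow_natCast, ← one_div]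
    exact (le_div_iff₀ hp0).mpr h
  exact_mod_cast hdvd
end
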